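/- Let x be a complex number and α, β complex numbers such that none of 2α, 2β, α+1/2, β+1/2, and α+β is a nonpositive integer. Then ₁F₁(α; 2α; x) · ₁F₁(β; 2β; −x) = ₂F₃((α+β)/2, (α+β+1)/2; α+1/2, β+1/2, α+β; x²/4). -/

import Mathlib

/-- Pochhammer symbol (rising factorial) `(c)_k = c (c+1) ⋯ (c+k-1)` for complex `c`. -/
noncomputable def poch (c : ℂ) (k : ℕ) : ℂ := ∏ l ∈ Finset.range k, (c + l)

/-- Generalized hypergeometric series `ₚF_q(a; b; x) = Σ_k (a₁)_k⋯(a_p)_k / ((b₁)_k⋯(b_q)_k) · x^k/k!`. -/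
noncomputable def pFq (a b : List ℂ) (x : ℂ) : ℂ :=
  ∑' k : ℕ, ((a.map (fun c => poch c k)).prod / (b.map (fun c => poch c k)).prod)
    * x ^ k / (Nat.factorial k)

/-- `c` is not a nonpositive integer, i.e. `c ≠ 0, -1, -2, …`. -/
def NotNonposInt (c : ℂ) : Prop := ∀ n : ℕ, c ≠ -(n : ℂ)

section Pochhammer

theorem poch_zero (c : ℂ) : poch c 0 = 1 := by simp [poch]

theorem poch_succ (c : ℂ) (k : ℕ) : poch c (k + 1) = poch c k * (c + k) := by
  simp [poch, Finset.prod_range_succ]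

theorem poch_add (c : ℂ) (m n : ℕ) : poch c (m + n) = poch c m * poch (c + m) n := by
  simp [poch, Finset.prod_range_add, add_assoc]

theorem NotNonposInt.add_natCast_ne_zero {c : ℂ} (hc : NotNonposInt c) (n : ℕ) :
    c + n ≠ 0 := fun h => hc n (eq_neg_of_add_eq_zero_left h)

theorem poch_ne_zero {c : ℂ} (hc : NotNonposInt c) (k : ℕ) : poch c k ≠ 0 :=
  Finset.prod_ne_zero_iff.mpr fun l _ => hc.add_natCast_ne_zero l

theorem poch_half_mul_poch_half (s : ℂ) (k : ℕ) :
    poch (s / 2) k * poch ((s + 1) / 2) k * 4 ^ k = poch s (2 * k) := by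
  induction k with
  | zero => simp [poch_zero]
  | succ k ih =>
    rw [show 2 * (k + 1) = 2 * k + 1 + 1 by ring, poch_succ s, poch_succ s, ← ih,
      poch_succ, poch_succ]
    push_cast
    ring

theorem poch_eq_factorial_mul_choose (c : ℂ) (n : ℕ) :
    poch c n = n.factorial * Ring.choose (c + n - 1) n := by
  rw [← Ring.multichoose_eq, ← nsmul_eq_mul, Ring.factorial_nsmul_multichoose_eq_ascPochhammer,
    Polynomial.ascPochhammer_smeval_eq_eval]
  induction n with
  | zero => simp [poch_zero]
  | succ n ih => rw [poch_succ, ih, ascPochhammer_succ_eval]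

/-- Chu–Vandermonde summation, in the form of the Cauchy product of two `₀F₁` series. -/
theorem sum_antidiagonal_inv_poch_mul {a b : ℂ} (ha : NotNonposInt a) (hb : NotNonposInt b)
    (n : ℕ) :
    ∑ p ∈ Finset.HasAntidiagonal.antidiagonal n,
        1 / (poch a p.1 * p.1.factorial) * (1 / (poch b p.2 * p.2.factorial)) =
      poch (a + b - 1 + n) n / (poch a n * poch b n * n.factorial) := by
  have hchoose : Ring.choose (a + b - 1 + n + n - 1) n =
      ∑ p ∈ Finset.HasAntidiagonal.antidiagonal n,
        Ring.choose (b + n - 1) p.1 * Ring.choose (a + n - 1) p.2 := by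
    rw [← Ring.add_choose_eq n (Commute.all _ _)]
    ring_nf
  have hn : (n.factorial : ℂ) ≠ 0 := Nat.cast_ne_zero.mpr n.factorial_ne_zero
  rw [poch_eq_factorial_mul_choose (a + b - 1 + n), hchoose, mul_comm (n.factorial : ℂ),
    mul_div_mul_right _ _ hn, Finset.sum_div]
  refine Finset.sum_congr rfl fun p hp => ?_
  have hsum := Finset.HasAntidiagonal.mem_antidiagonal.mp hp
  have hcast : (p.1 : ℂ) + p.2 = n := by exact_mod_cast hsum
  have hA : poch a n = poch a p.1 * (p.2.factorial * Ring.choose (a + n - 1) p.2) := by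
    rw [← hcast, ← add_assoc, ← poch_eq_factorial_mul_choose, ← poch_add, hsum]
  have hB : poch b n = poch b p.2 * (p.1.factorial * Ring.choose (b + n - 1) p.1) := by
    rw [← hcast, add_comm (p.1 : ℂ), ← add_assoc, ← poch_eq_factorial_mul_choose, ← poch_add,
      add_comm p.2, hsum]
  have hA0 := poch_ne_zero ha n
  have hB0 := poch_ne_zero hb n
  rw [hA] at hA0 ⊢
  rw [hB] at hB0 ⊢
  simp only [ne_eq, mul_eq_zero, not_or] at hA0 hB0
  obtain ⟨hA1, hA2, hA3⟩ := hA0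
  obtain ⟨hB1, hB2, hB3⟩ := hB0
  field_simp

end Pochhammer

section PowerSeries

open PowerSeries

/-- The coefficients of a power series solution with constant term `1` of the confluent
hypergeometric equation with parameters `c` and `2c`. -/
theorem coeff_of_kummer_equation {c : ℂ} (hc : NotNonposInt (2 * c)) {F : ℂ⟦X⟧}
    (hF : X * d⁄dX ℂ (d⁄dX ℂ F) + (C (2 * c) - X) * d⁄dX ℂ F - C c * F = 0)
    (h0 : constantCoeff F = 1) (n : ℕ) :
    coeff n F = poch c n / (poch (2 * c) n * n.factorial) := by
  have hrec : ∀ n : ℕ, (n + 1) * (2 * c + n) * coeff (n + 1) F = (c + n) * coeff n F := by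
    intro n
    have h := congrArg (coeff n) hF
    cases n with
    | zero =>
      simp only [map_sub, map_add, map_zero, sub_mul, coeff_C_mul, coeff_zero_X_mul,
        coeff_derivative] at h
      linear_combination h
    | succ n =>
      simp only [map_sub, map_add, map_zero, sub_mul, coeff_C_mul, coeff_succ_X_mul,
        coeff_derivative] at h
      push_cast at h ⊢
      linear_combination h
  induction n with
  | zero => simpa [poch_zero] using h0
  | succ n ih =>
    have h := hrec n
    have h1 := hc.add_natCast_ne_zero n
    have h2 : (n : ℂ) + 1 ≠ 0 := n.cast_add_one_ne_zero
    have h3 := poch_ne_zero hc n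
    have h4 : (n.factorial : ℂ) ≠ 0 := Nat.cast_ne_zero.mpr n.factorial_ne_zero
    rw [ih] at h
    rw [poch_succ, poch_succ, Nat.factorial_succ]
    push_cast
    field_simp at h ⊢
    linear_combination h

/-- The power series `₀F₁(; a; x² / 16)`. -/
noncomputable def besselSeries (a : ℂ) : ℂ⟦X⟧ :=
  expand 2 two_ne_zero (mk fun k => (1 / 16) ^ k * (1 / (poch a k * k.factorial)))

theorem besselSeries_equation {c : ℂ} (hc : NotNonposInt (c + 1 / 2)) :
    X * d⁄dX ℂ (d⁄dX ℂ (besselSeries (c + 1 / 2))) +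
        C (2 * c) * d⁄dX ℂ (besselSeries (c + 1 / 2)) =
      C (1 / 4) * (X * besselSeries (c + 1 / 2)) := by
  ext n
  cases n with
  | zero =>
    simp only [map_add, coeff_zero_X_mul, coeff_C_mul, coeff_derivative, besselSeries]
    rw [coeff_expand_of_not_dvd _ _ _ (by omega)]
    ring
  | succ n =>
    simp only [map_add, coeff_succ_X_mul, coeff_C_mul, coeff_derivative, besselSeries]
    obtain ⟨k, rfl | rfl⟩ := n.even_or_odd'
    · rw [show 2 * k + 1 + 1 = 2 * (k + 1) by ring, coeff_expand_mul, coeff_expand_mul, coeff_mk,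
        coeff_mk, poch_succ, Nat.factorial_succ]
      have h1 := hc.add_natCast_ne_zero k
      have h2 : (k : ℂ) + 1 ≠ 0 := k.cast_add_one_ne_zero
      have h3 := poch_ne_zero hc k
      have h4 : (k.factorial : ℂ) ≠ 0 := Nat.cast_ne_zero.mpr k.factorial_ne_zero
      push_cast
      generalize poch (c + 1 / 2) k = P at *
      have h5 : c * 2 + 1 + 2 * k ≠ 0 := fun h => h1 (by linear_combination h / 2)
      field_simp
      ring
    · rw [coeff_expand_of_not_dvd _ _ _ (by omega), coeff_expand_of_not_dvd _ _ _ (by omega)]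
      ring

theorem derivative_rescale_exp (r : ℂ) :
    d⁄dX ℂ (rescale r (exp ℂ)) = C r * rescale r (exp ℂ) := by
  ext n
  have h := congrArg (coeff n) (derivative_exp ℂ)
  rw [coeff_derivative] at h
  rw [coeff_derivative, coeff_C_mul, coeff_rescale, coeff_rescale, ← h]
  ring

/-- The second Kummer transformation, for power series. -/
theorem coeff_exp_mul_besselSeries {c : ℂ} (h1 : NotNonposInt (2 * c))
    (h2 : NotNonposInt (c + 1 / 2)) (n : ℕ) :
    coeff n (rescale (1 / 2) (exp ℂ) * besselSeries (c + 1 / 2)) =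
      poch c n / (poch (2 * c) n * n.factorial) := by
  refine coeff_of_kummer_equation h1 ?_ ?_ n
  · have hB := besselSeries_equation h2
    have hE := derivative_rescale_exp (1 / 2)
    generalize besselSeries (c + 1 / 2) = B at *
    generalize rescale (1 / 2) (exp ℂ) = E at *
    have hquarter : C (1 / 4 : ℂ) = C (1 / 2) * C (1 / 2) := by
      rw [← map_mul]; norm_num
    have hhalf : (2 : ℂ⟦X⟧) * C (1 / 2) = 1 := by
      rw [← map_ofNat C 2, ← map_mul]; norm_num
    simp only [Derivation.leibniz, map_add, smul_eq_mul, hE, derivative_C]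
    rw [hquarter] at hB
    rw [map_mul, map_ofNat] at hB ⊢
    generalize C (1 / 2 : ℂ) = h at *
    linear_combination E * hB +
      E * (X * d⁄dX ℂ B + h * X * B + C c * B) * hhalf
  · simp [besselSeries, ← coeff_zero_eq_constantCoeff_apply, coeff_rescale, poch_zero,
      coeff_expand, coeff_mul]

theorem rescale_neg_one_besselSeries (a : ℂ) :
    rescale (-1) (besselSeries a) = besselSeries a := by
  ext n
  rw [coeff_rescale, besselSeries]
  obtain ⟨k, rfl | rfl⟩ := n.even_or_odd'
  · simp
  · rw [coeff_expand_of_not_dvd _ _ _ (by omega), mul_zero]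

theorem besselSeries_mul_besselSeries {a b : ℂ} (ha : NotNonposInt a) (hb : NotNonposInt b) :
    besselSeries a * besselSeries b = expand 2 two_ne_zero (mk fun k =>
      (1 / 16) ^ k * (poch (a + b - 1 + k) k / (poch a k * poch b k * k.factorial))) := by
  rw [besselSeries, besselSeries, ← map_mul]
  congr 1
  ext n
  rw [coeff_mul, coeff_mk, ← sum_antidiagonal_inv_poch_mul ha hb, Finset.mul_sum]
  refine Finset.sum_congr rfl fun p hp => ?_
  rw [coeff_mk, coeff_mk, ← Finset.HasAntidiagonal.mem_antidiagonal.mp hp, pow_add]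
  ring

/-- The Cauchy product of the series of `₁F₁(α; 2α; x)` and `₁F₁(β; 2β; -x)`. -/
theorem sum_antidiagonal_confluent_mul {α β : ℂ}
    (h1 : NotNonposInt (2 * α)) (h2 : NotNonposInt (2 * β))
    (h3 : NotNonposInt (α + 1 / 2)) (h4 : NotNonposInt (β + 1 / 2)) (n : ℕ) :
    ∑ p ∈ Finset.HasAntidiagonal.antidiagonal n, poch α p.1 / (poch (2 * α) p.1 * p.1.factorial) *
        ((-1) ^ p.2 * (poch β p.2 / (poch (2 * β) p.2 * p.2.factorial))) =
      coeff n (expand 2 two_ne_zero (mk fun k => (1 / 16) ^ k * (poch (α + β + k) k /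
        (poch (α + 1 / 2) k * poch (β + 1 / 2) k * k.factorial)))) := by
  have hexp : rescale (1 / 2) (exp ℂ) * rescale (-1) (rescale (1 / 2) (exp ℂ)) = 1 := by
    rw [rescale_rescale, exp_mul_exp_eq_exp_add]
    simp
  have hprod : rescale (1 / 2) (exp ℂ) * besselSeries (α + 1 / 2) *
      rescale (-1) (rescale (1 / 2) (exp ℂ) * besselSeries (β + 1 / 2)) =
        besselSeries (α + 1 / 2) * besselSeries (β + 1 / 2) := by
    rw [map_mul, rescale_neg_one_besselSeries, mul_mul_mul_comm, hexp, one_mul]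
  have h := congrArg (coeff n) hprod
  rw [besselSeries_mul_besselSeries h3 h4, coeff_mul,
    show α + 1 / 2 + (β + 1 / 2) - 1 = α + β by ring] at h
  rw [← h]
  refine Finset.sum_congr rfl fun p _ => ?_
  rw [coeff_rescale, coeff_exp_mul_besselSeries h1 h3, coeff_exp_mul_besselSeries h2 h4]

end PowerSeries

open Filter Topology in
theorem summable_norm_confluent {c : ℂ} (hc : NotNonposInt (2 * c)) (x : ℂ) :
    Summable fun n : ℕ => ‖poch c n / poch (2 * c) n * x ^ n / n.factorial‖ := by
  have hlim : Tendsto (fun n : ℕ => (c + 1 * n) / (2 * c + 1 * n) * (x * (1 / ((n : ℂ) + 1))))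
      atTop (𝓝 0) := by
    simpa using (tendsto_add_mul_div_add_mul_atTop_nhds c (2 * c) 1 one_ne_zero).mul
      ((tendsto_one_div_add_atTop_nhds_zero_nat (𝕜 := ℂ)).const_mul x)
  refine summable_of_ratio_norm_eventually_le (r := 1 / 2) (by norm_num) ?_
  have hsmall := (tendsto_zero_iff_norm_tendsto_zero.mp hlim).eventually_le_const
    (show (0 : ℝ) < 1 / 2 by norm_num)
  filter_upwards [hsmall] with n hn
  rw [norm_norm, norm_norm]
  refine le_trans (le_of_eq ?_) (mul_le_mul_of_nonneg_right hn (norm_nonneg _))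
  rw [← norm_mul]
  congr 1
  have h1 := hc.add_natCast_ne_zero n
  have h2 : (n : ℂ) + 1 ≠ 0 := n.cast_add_one_ne_zero
  have h3 := poch_ne_zero hc n
  have h4 : (n.factorial : ℂ) ≠ 0 := Nat.cast_ne_zero.mpr n.factorial_ne_zero
  rw [poch_succ, poch_succ, Nat.factorial_succ, one_mul, pow_succ x]
  push_cast
  field_simp

theorem bailey_identity (x α β : ℂ)
    (h1 : NotNonposInt (2*α)) (h2 : NotNonposInt (2*β))
    (h3 : NotNonposInt (α + 1/2)) (h4 : NotNonposInt (β + 1/2))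
    (h5 : NotNonposInt (α + β)) :
    pFq [α] [2*α] x * pFq [β] [2*β] (-x) =
      pFq [(α+β)/2, (α+β+1)/2] [α+1/2, β+1/2, α+β] (x^2/4) := by
  simp only [pFq, List.map_cons, List.map_nil, List.prod_cons, List.prod_nil, mul_one]
  rw [tsum_mul_tsum_eq_tsum_sum_antidiagonal_of_summable_norm (summable_norm_confluent h1 x)
    (summable_norm_confluent h2 (-x))]
  have hcoeff : ∀ n : ℕ, ∑ p ∈ Finset.HasAntidiagonal.antidiagonal n,
      poch α p.1 / poch (2 * α) p.1 * x ^ p.1 / p.1.factorial *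
        (poch β p.2 / poch (2 * β) p.2 * (-x) ^ p.2 / p.2.factorial) =
      x ^ n * PowerSeries.coeff n (PowerSeries.expand 2 two_ne_zero (PowerSeries.mk fun k =>
        (1 / 16) ^ k * (poch (α + β + k) k /
          (poch (α + 1 / 2) k * poch (β + 1 / 2) k * k.factorial)))) := by
    intro n
    rw [← sum_antidiagonal_confluent_mul h1 h2 h3 h4, Finset.mul_sum]
    refine Finset.sum_congr rfl fun p hp => ?_
    rw [← Finset.HasAntidiagonal.mem_antidiagonal.mp hp, pow_add, neg_pow]
    ring
  simp only [hcoeff]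
  rw [← (mul_right_injective₀ (two_ne_zero' ℕ)).tsum_eq]
  · refine tsum_congr fun k => ?_
    rw [PowerSeries.coeff_expand_mul, PowerSeries.coeff_mk]
    have hdup := poch_half_mul_poch_half (α + β) k
    rw [two_mul, poch_add] at hdup
    have h6 := poch_ne_zero h3 k
    have h7 := poch_ne_zero h4 k
    have h8 := poch_ne_zero h5 k
    have h9 : (k.factorial : ℂ) ≠ 0 := Nat.cast_ne_zero.mpr k.factorial_ne_zero
    have h16 : (16 : ℂ) ^ k = 4 ^ k * 4 ^ k := by rw [← mul_pow]; norm_num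
    rw [div_pow, div_pow, one_pow, h16, pow_mul]
    have h10 : (4 : ℂ) ^ k ≠ 0 := pow_ne_zero _ (by norm_num)
    generalize poch (α + 1 / 2) k = A at *
    generalize poch (β + 1 / 2) k = B at *
    generalize (4 : ℂ) ^ k = Q at *
    generalize (x ^ 2) ^ k = Y at *
    rw [eq_div_of_mul_eq h10 hdup]
    field_simp
  · intro n hn
    by_contra hodd
    refine hn ?_
    dsimp only
    rw [PowerSeries.coeff_expand_of_not_dvd, mul_zero]
    rintro ⟨k, rfl⟩
    exact hodd ⟨k, rfl⟩
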